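/- Let n ≥ 1, let x = (x¹,…,xⁿ) ∈ 𝒳ⁿ with empirical distribution m(x′) := (1/n)·Σ_{i=1}^n 1(xⁱ = x′), let γ ∈ 𝒢, and let W¹,…,Wⁿ be i.i.d. 𝒲-valued random variables with pmf P_W. Define the (random) next empirical distribution m⁺(y) := (1/n)·Σ_{i=1}^n 1( f(xⁱ, γ(xⁱ), m, Wⁱ) = y ). Then E[ ‖ m⁺ − f̂(m,γ) ‖∞ ] ≤ |𝒳| / √n. -/

import Mathlib

open Finset

noncomputable section

variable {X U W : Type*}

/-- `z ∈ I(𝒳)`: componentwise in `[0,1]`. -/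
def inI (z : X → ℝ) : Prop := ∀ x, 0 ≤ z x ∧ z x ≤ 1

/-- `z ∈ Δ(𝒳)`: the probability simplex on `X`. -/
def inDelta [Fintype X] (z : X → ℝ) : Prop := inI z ∧ ∑ x, z x = 1

/-- `m ∈ M_n`: empirical distributions of `n` points. -/
def inMn [Fintype X] (n : ℕ) (m : X → ℝ) : Prop :=
  inDelta m ∧ ∀ x, ∃ k : ℤ, (n : ℝ) * m x = (k : ℝ)

/-- transition kernel `p(y|x,u,z) = Σ_w 1(f(x,u,z,w)=y)·P_W(w)`. -/
def ker [DecidableEq X] [Fintype W] (f : X → U → (X → ℝ) → W → X) (Pw : W → ℝ)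
    (y x : X) (u : U) (z : X → ℝ) : ℝ :=
  ∑ w, if f x u z w = y then Pw w else 0

/-- deterministic mean-field update `f̂(z,γ)(y) = Σ_x z(x)·p(y|x,γ(x),z)`. -/
def fhat [Fintype X] [DecidableEq X] [Fintype W] (f : X → U → (X → ℝ) → W → X)
    (Pw : W → ℝ) (z : X → ℝ) (γ : X → U) : X → ℝ :=
  fun y => ∑ x, z x * ker f Pw y x (γ x) z

/-- expected per-step cost `ĉ(z,γ) = Σ_x z(x)·ℓ(x,γ(x),z)`. -/
def chat [Fintype X] (ℓ : X → U → (X → ℝ) → ℝ) (z : X → ℝ) (γ : X → U) : ℝ :=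
  ∑ x, z x * ℓ x (γ x) z

/-- empirical distribution of `n` points of `X`. -/
def emp [Fintype X] [DecidableEq X] {n : ℕ} (x : Fin n → X) : X → ℝ :=
  fun y => (1 / (n : ℝ)) * ∑ i, if x i = y then (1 : ℝ) else 0

/-- empirical distribution of the noise vector `ω`. -/
def ehat [DecidableEq W] {n : ℕ} (ω : Fin n → W) (w : W) : ℝ :=
  (1 / (n : ℝ)) * ∑ i, if ω i = w then (1 : ℝ) else 0

/-- empirical mean-field update
`f̄(m,γ,𝐰)(y) = Σ_x Σ_w 1(f(x,γ(x),m,w)=y)·m(x)·ê_𝐰(w)`. -/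
def fbar [Fintype X] [DecidableEq X] [Fintype W] [DecidableEq W] {n : ℕ}
    (f : X → U → (X → ℝ) → W → X) (m : X → ℝ) (γ : X → U) (ω : Fin n → W) : X → ℝ :=
  fun y => ∑ x, ∑ w, (if f x (γ x) m w = y then (1 : ℝ) else 0) * m x * ehat ω w

lemma aux_one [Fintype W] (Pw : W → ℝ) (hPw1 : ∑ w, Pw w = 1) (n : ℕ) :
    ∑ ω : Fin n → W, ∏ i, Pw (ω i) = 1 := by
  classical
  have h := Finset.prod_univ_sum (fun _ : Fin n => (Finset.univ : Finset W)) (fun _ w => Pw w)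
  rw [Fintype.piFinset_univ] at h
  rw [← h]
  simp [hPw1]

lemma aux_cross [Fintype W] (Pw : W → ℝ) (n : ℕ)
    (g : Fin n → W → ℝ) (hg0 : ∀ i, ∑ w, Pw w * g i w = 0) (i j : Fin n) (hij : i ≠ j) :
    ∑ ω : Fin n → W, (∏ k, Pw (ω k)) * (g i (ω i) * g j (ω j)) = 0 := by
  classical
  have h := Finset.prod_univ_sum (fun _ : Fin n => (Finset.univ : Finset W))
    (fun k w => Pw w * ((if k = i then g k w else 1) * (if k = j then g k w else 1)))
  rw [Fintype.piFinset_univ] at h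
  have h2 : ∀ ω : Fin n → W, (∏ k, Pw (ω k)) * (g i (ω i) * g j (ω j)) =
      ∏ k, Pw (ω k) * ((if k = i then g k (ω k) else 1) * (if k = j then g k (ω k) else 1)) := by
    intro ω
    rw [Finset.prod_mul_distrib, Finset.prod_mul_distrib]
    simp
  rw [Finset.sum_congr rfl (fun ω _ => h2 ω), ← h]
  apply Finset.prod_eq_zero (Finset.mem_univ i)
  simp [hij, hg0]

lemma aux_sq [Fintype W] (Pw : W → ℝ) (hPw0 : ∀ w, 0 ≤ Pw w) (hPw1 : ∑ w, Pw w = 1) (n : ℕ)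
    (g : Fin n → W → ℝ) (hg0 : ∀ i, ∑ w, Pw w * g i w = 0) (hg1 : ∀ i w, |g i w| ≤ 1) :
    ∑ ω : Fin n → W, (∏ k, Pw (ω k)) * (∑ i, g i (ω i)) ^ 2 ≤ n := by
  classical
  have h1 : ∑ ω : Fin n → W, (∏ k, Pw (ω k)) * (∑ i, g i (ω i)) ^ 2 =
      ∑ i, ∑ j, ∑ ω : Fin n → W, (∏ k, Pw (ω k)) * (g i (ω i) * g j (ω j)) := by
    simp_rw [sq, Finset.sum_mul_sum, Finset.mul_sum]
    rw [Finset.sum_comm]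
    refine Finset.sum_congr rfl fun i _ => ?_
    rw [Finset.sum_comm]
  rw [h1]
  have h2 : ∀ i : Fin n, ∑ j, ∑ ω : Fin n → W, (∏ k, Pw (ω k)) * (g i (ω i) * g j (ω j)) ≤ 1 := by
    intro i
    rw [Finset.sum_eq_single i (fun j _ hj => aux_cross Pw n g hg0 i j hj.symm) (by simp)]
    rw [← aux_one Pw hPw1 n]
    refine Finset.sum_le_sum fun ω _ => ?_
    have h3 : g i (ω i) * g i (ω i) ≤ 1 := by
      have := abs_le.1 (hg1 i (ω i))
      nlinarith
    exact mul_le_of_le_one_right (Finset.prod_nonneg fun k _ => hPw0 _) h3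
  calc _ ≤ ∑ i : Fin n, (1 : ℝ) := Finset.sum_le_sum fun i _ => h2 i
    _ = n := by simp

lemma aux_abs [Fintype W] (Pw : W → ℝ) (hPw0 : ∀ w, 0 ≤ Pw w) (hPw1 : ∑ w, Pw w = 1) (n : ℕ)
    (g : Fin n → W → ℝ) (hg0 : ∀ i, ∑ w, Pw w * g i w = 0) (hg1 : ∀ i w, |g i w| ≤ 1) :
    ∑ ω : Fin n → W, (∏ k, Pw (ω k)) * |∑ i, g i (ω i)| ≤ Real.sqrt n := by
  apply Real.le_sqrt_of_sq_le
  refine le_trans ?_ (aux_sq Pw hPw0 hPw1 n g hg0 hg1)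
  have h := Finset.sum_sq_le_sum_mul_sum_of_sq_eq_mul (Finset.univ : Finset (Fin n → W))
    (r := fun ω => (∏ k, Pw (ω k)) * |∑ i, g i (ω i)|)
    (f := fun ω => ∏ k, Pw (ω k))
    (g := fun ω => (∏ k, Pw (ω k)) * (∑ i, g i (ω i)) ^ 2)
    (fun ω _ => Finset.prod_nonneg fun k _ => hPw0 _)
    (fun ω _ => mul_nonneg (Finset.prod_nonneg fun k _ => hPw0 _) (sq_nonneg _))
    (fun ω _ => by rw [mul_pow, sq_abs]; ring)
  rwa [aux_one Pw hPw1 n, one_mul] at h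

lemma aux_fhat [Fintype X] [DecidableEq X] [Fintype W]
    (Pw : W → ℝ) (f : X → U → (X → ℝ) → W → X) (n : ℕ) (x : Fin n → X) (γ : X → U) (y : X) :
    fhat f Pw (emp x) γ y = (1 / (n : ℝ)) * ∑ i, ker f Pw y (x i) (γ (x i)) (emp x) := by
  have h : ∀ m : X → ℝ, ∑ a, emp x a * ker f Pw y a (γ a) m =
      (1 / (n : ℝ)) * ∑ i, ker f Pw y (x i) (γ (x i)) m := by
    intro m
    simp only [emp, mul_assoc, Finset.sum_mul]
    rw [← Finset.mul_sum, Finset.sum_comm]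
    simp
  exact h _

theorem stmt8 [Fintype X] [Nonempty X] [DecidableEq X] [Fintype U] [Nonempty U]
    [Fintype W] [Nonempty W] [DecidableEq W]
    (Pw : W → ℝ) (hPw0 : ∀ w, 0 ≤ Pw w) (hPw1 : ∑ w, Pw w = 1)
    (f : X → U → (X → ℝ) → W → X)
    (n : ℕ) (hn : 1 ≤ n) (x : Fin n → X) (γ : X → U) :
    ∑ ω : Fin n → W, (∏ i, Pw (ω i)) *
        ‖(fun y => (1 / (n : ℝ)) *
            ∑ i, if f (x i) (γ (x i)) (emp x) (ω i) = y then (1 : ℝ) else 0) -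
          fhat f Pw (emp x) γ‖
      ≤ (Fintype.card X : ℝ) / Real.sqrt n := by
  have hn0 : (0 : ℝ) < n := by exact_mod_cast hn
  set p : X → Fin n → ℝ := fun y i => ker f Pw y (x i) (γ (x i)) (emp x) with hp
  set g : X → Fin n → W → ℝ := fun y i w =>
    (if f (x i) (γ (x i)) (emp x) w = y then (1 : ℝ) else 0) - p y i with hg
  have hp0 : ∀ y i, 0 ≤ p y i := fun y i =>
    Finset.sum_nonneg fun w _ => by split_ifs <;> simp [hPw0]
  have hp1 : ∀ y i, p y i ≤ 1 := fun y i => by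
    rw [← hPw1]
    exact Finset.sum_le_sum fun w _ => by split_ifs <;> simp [hPw0]
  have hg0 : ∀ y i, ∑ w, Pw w * g y i w = 0 := by
    intro y i
    simp only [hg, mul_sub, Finset.sum_sub_distrib, ← Finset.sum_mul, hPw1, one_mul]
    simp [hp, ker]
  have hg1 : ∀ y i w, |g y i w| ≤ 1 := by
    intro y i w
    have h0 := hp0 y i
    have h1 := hp1 y i
    simp only [hg]
    rw [abs_le]
    split_ifs <;> constructor <;> linarith
  have hnorm : ∀ ω : Fin n → W, ‖(fun y => (1 / (n : ℝ)) *
            ∑ i, if f (x i) (γ (x i)) (emp x) (ω i) = y then (1 : ℝ) else 0) -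
          fhat f Pw (emp x) γ‖ ≤ ∑ y, (1 / (n : ℝ)) * |∑ i, g y i (ω i)| := by
    intro ω
    have hnn : ∀ y : X, 0 ≤ (1 / (n : ℝ)) * |∑ i, g y i (ω i)| := fun y => by positivity
    rw [pi_norm_le_iff_of_nonneg (Finset.sum_nonneg fun y _ => hnn y)]
    intro y
    refine le_trans (le_of_eq ?_) (Finset.single_le_sum (fun y _ => hnn y) (Finset.mem_univ y))
    rw [Pi.sub_apply, aux_fhat, ← mul_sub, ← Finset.sum_sub_distrib, Real.norm_eq_abs, abs_mul,
      abs_of_nonneg (by positivity : (0 : ℝ) ≤ 1 / n)]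
  calc _ ≤ ∑ ω : Fin n → W, (∏ i, Pw (ω i)) * ∑ y, (1 / (n : ℝ)) * |∑ i, g y i (ω i)| :=
        Finset.sum_le_sum fun ω _ => mul_le_mul_of_nonneg_left (hnorm ω)
          (Finset.prod_nonneg fun k _ => hPw0 _)
    _ = ∑ y, (1 / (n : ℝ)) * ∑ ω : Fin n → W, (∏ i, Pw (ω i)) * |∑ i, g y i (ω i)| := by
        simp_rw [Finset.mul_sum]
        rw [Finset.sum_comm]
        refine Finset.sum_congr rfl fun y _ => Finset.sum_congr rfl fun ω _ => ?_
        ring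
    _ ≤ ∑ y : X, (1 / (n : ℝ)) * Real.sqrt n :=
        Finset.sum_le_sum fun y _ => mul_le_mul_of_nonneg_left
          (aux_abs Pw hPw0 hPw1 n (g y) (hg0 y) (hg1 y)) (by positivity)
    _ = (Fintype.card X : ℝ) / Real.sqrt n := by
        rw [Finset.sum_const, Finset.card_univ, nsmul_eq_mul, div_eq_mul_inv (Fintype.card X : ℝ)]
        congr 1
        rw [one_div, ← Real.sqrt_div_self]
        ring
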